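/- arXiv:1812.09808 — 3 statements merged into one kernel-verified Lean document; each statement's English description precedes it below -/
import Mathlib

section
/- Under the standing assumptions, let ε > 0, r > 0, and k ≥ 1. Let ṽ, v*, v^π̃ : X → ℝ be Borel-measurable with finite ‖·‖_ξ-norm, and let π̃ : X → U be Borel-measurable with π̃(x) ∈ U(x), such that: T v* = v* (pointwise), T^π̃ v^π̃ = v^π̃ (pointwise), T^π̃ ṽ = T ṽ (pointwise), and ‖ṽ − v*‖_ξ ≤ k τ^{k−1} r / (1−τ), where τ := αβ ∈ (0,1). If k τ^k < (1−τ)² ε / (2r), then ‖v^π̃ − v*‖_ξ < ε, i.e., π̃ is an ε-optimal policy. -/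
open MeasureTheory

/-- The weighted sup-norm `‖g‖_ξ := sup_x |g(x)| / ξ(x)`. -/
noncomputable def wnorm {X : Type*} (ξ : X → ℝ) (g : X → ℝ) : ℝ :=
  ⨆ x, |g x| / ξ x

/-- The distributionally robust Bellman operator
`(T v)(x) := inf_{u ∈ U(x)} sup_{μ ∈ D} [ c(x,u) + α ∫ v(f(x,u,w)) μ(dw) ]`. -/
noncomputable def Tbell {X U W : Type*} [MeasurableSpace W]
    (f : X → U → W → X) (c : X → U → ℝ) (α : ℝ)
    (Uadm : X → Set U) (D : Set (Measure W)) (v : X → ℝ) (x : X) : ℝ :=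
  ⨅ u : Uadm x, ⨆ μ : D, c x u + α * ∫ w, v (f x u w) ∂(μ : Measure W)

/-- The policy Bellman operator
`(T^π v)(x) := sup_{μ ∈ D} [ c(x,π(x)) + α ∫ v(f(x,π(x),w)) μ(dw) ]`. -/
noncomputable def Tpol {X U W : Type*} [MeasurableSpace W]
    (f : X → U → W → X) (c : X → U → ℝ) (α : ℝ)
    (π : X → U) (D : Set (Measure W)) (v : X → ℝ) (x : X) : ℝ :=
  ⨆ μ : D, c x (π x) + α * ∫ w, v (f x (π x) w) ∂(μ : Measure W)

/-- Two real families at uniform distance at most `C` have suprema at distance at most `C`; no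
boundedness is required because both suprema vanish when the families are unbounded. -/
theorem Real.abs_iSup_sub_iSup_le {ι : Sort*} {f g : ι → ℝ} {C : ℝ} (hC : 0 ≤ C)
    (h : ∀ i, |f i - g i| ≤ C) : |(⨆ i, f i) - ⨆ i, g i| ≤ C := by
  rcases isEmpty_or_nonempty ι with hι | hι
  · simpa [Real.iSup_of_isEmpty] using hC
  have hbdd : ∀ {p q : ι → ℝ}, (∀ i, p i ≤ q i + C) →
      BddAbove (Set.range q) → BddAbove (Set.range p) := by
    rintro p q hpq ⟨M, hM⟩
    refine ⟨M + C, ?_⟩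
    rintro _ ⟨i, rfl⟩
    linarith [hpq i, hM ⟨i, rfl⟩]
  have hfg : ∀ i, f i ≤ g i + C := fun i => by linarith [(abs_le.1 (h i)).2]
  have hgf : ∀ i, g i ≤ f i + C := fun i => by linarith [(abs_le.1 (h i)).1]
  by_cases hg : BddAbove (Set.range g)
  · have hf := hbdd hfg hg
    have h₁ : (⨆ i, f i) ≤ (⨆ i, g i) + C :=
      ciSup_le fun i => by linarith [hfg i, le_ciSup hg i]
    have h₂ : (⨆ i, g i) ≤ (⨆ i, f i) + C :=
      ciSup_le fun i => by linarith [hgf i, le_ciSup hf i]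
    exact abs_le.2 ⟨by linarith, by linarith⟩
  · have hf : ¬ BddAbove (Set.range f) := fun hf => hg (hbdd hgf hf)
    simpa [Real.iSup_of_not_bddAbove hf, Real.iSup_of_not_bddAbove hg] using hC

theorem Real.abs_iInf_sub_iInf_le {ι : Sort*} {f g : ι → ℝ} {C : ℝ} (hC : 0 ≤ C)
    (h : ∀ i, |f i - g i| ≤ C) : |(⨅ i, f i) - ⨅ i, g i| ≤ C := by
  have hneg := Real.abs_iSup_sub_iSup_le (f := fun i => -f i) (g := fun i => -g i) hC
    fun i => by
      rw [neg_sub_neg, abs_sub_comm]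
      exact h i
  have hiSup : ∀ p : ι → ℝ, (⨆ i, -p i) = -⨅ i, p i := fun p => by
    rw [iInf, Real.sInf_def, neg_neg, Set.neg_range]
    rfl
  rwa [hiSup, hiSup, neg_sub_neg, abs_sub_comm] at hneg

section WeightedNorm

variable {X : Type*} {ξ : X → ℝ}

theorem wnorm_nonneg (hξ : ∀ x, 0 < ξ x) (g : X → ℝ) : 0 ≤ wnorm ξ g :=
  Real.iSup_nonneg fun x => div_nonneg (abs_nonneg _) (hξ x).le

theorem abs_le_wnorm_mul (hξ : ∀ x, 0 < ξ x) {g : X → ℝ}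
    (hg : BddAbove (Set.range fun x => |g x| / ξ x)) (x : X) : |g x| ≤ wnorm ξ g * ξ x :=
  (div_le_iff₀ (hξ x)).1 (le_ciSup hg x)

theorem wnorm_le_of_forall_abs_le (hξ : ∀ x, 0 < ξ x) {g : X → ℝ} {M : ℝ} (hM : 0 ≤ M)
    (h : ∀ x, |g x| ≤ M * ξ x) : wnorm ξ g ≤ M :=
  Real.iSup_le (fun x => (div_le_iff₀ (hξ x)).2 (h x)) hM

theorem bddAbove_range_abs_sub_div (hξ : ∀ x, 0 < ξ x) {g h : X → ℝ}
    (hg : BddAbove (Set.range fun x => |g x| / ξ x))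
    (hh : BddAbove (Set.range fun x => |h x| / ξ x)) :
    BddAbove (Set.range fun x => |g x - h x| / ξ x) := by
  refine ⟨wnorm ξ g + wnorm ξ h, ?_⟩
  rintro _ ⟨x, rfl⟩
  rw [div_le_iff₀ (hξ x)]
  linarith [abs_sub (g x) (h x), abs_le_wnorm_mul hξ hg x, abs_le_wnorm_mul hξ hh x]

theorem integrable_comp_of_abs_le_mul [MeasurableSpace X] {W : Type*} [MeasurableSpace W]
    {μ : Measure W} {φ : W → X} (hφ : Measurable φ) {v : X → ℝ} (hv : Measurable v) {M : ℝ}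
    (hM : ∀ x, |v x| ≤ M * ξ x) (hint : Integrable (fun w => ξ (φ w)) μ) :
    Integrable (fun w => v (φ w)) μ :=
  (hint.const_mul M).mono' (hv.comp hφ).aestronglyMeasurable (ae_of_all _ fun w => hM (φ w))

theorem abs_integral_comp_sub_le {W : Type*} [MeasurableSpace W]
    {μ : Measure W} {φ : W → X} {v v' : X → ℝ} {M : ℝ}
    (hv : Integrable (fun w => v (φ w)) μ) (hv' : Integrable (fun w => v' (φ w)) μ)
    (hint : Integrable (fun w => ξ (φ w)) μ) (h : ∀ x, |v x - v' x| ≤ M * ξ x) :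
    |∫ w, v (φ w) ∂μ - ∫ w, v' (φ w) ∂μ| ≤ M * ∫ w, ξ (φ w) ∂μ := by
  rw [← integral_sub hv hv', ← integral_const_mul]
  exact norm_integral_le_of_norm_le (f := fun w => v (φ w) - v' (φ w)) (hint.const_mul M)
    (ae_of_all _ fun w => h (φ w))

end WeightedNorm

section BellmanOperators

variable {X U W : Type*} [MeasurableSpace W] {f : X → U → W → X} {c : X → U → ℝ} {α C : ℝ}
  {D : Set (Measure W)} {v v' : X → ℝ} {x : X}

theorem abs_Tpol_sub_Tpol_le {π : X → U} (hα : 0 ≤ α) (hC : 0 ≤ C)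
    (h : ∀ μ ∈ D, |∫ w, v (f x (π x) w) ∂μ - ∫ w, v' (f x (π x) w) ∂μ| ≤ C) :
    |Tpol f c α π D v x - Tpol f c α π D v' x| ≤ α * C := by
  refine Real.abs_iSup_sub_iSup_le (mul_nonneg hα hC) fun μ => ?_
  rw [add_sub_add_left_eq_sub, ← mul_sub, abs_mul, abs_of_nonneg hα]
  exact mul_le_mul_of_nonneg_left (h μ μ.2) hα

theorem abs_Tbell_sub_Tbell_le {Uadm : X → Set U} (hα : 0 ≤ α) (hC : 0 ≤ C)
    (h : ∀ u ∈ Uadm x, ∀ μ ∈ D, |∫ w, v (f x u w) ∂μ - ∫ w, v' (f x u w) ∂μ| ≤ C) :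
    |Tbell f c α Uadm D v x - Tbell f c α Uadm D v' x| ≤ α * C :=
  Real.abs_iInf_sub_iInf_le (mul_nonneg hα hC) fun u =>
    abs_Tpol_sub_Tpol_le (π := fun _ => (u : U)) hα hC (h u u.2)

end BellmanOperators

/-- Proposition 4: iteration-count estimate for modified policy
iteration: if `T v* = v*`, `T^π̃ v^π̃ = v^π̃`, `π̃` is greedy with respect to `ṽ`,
`‖ṽ − v*‖_ξ ≤ k τ^(k−1) r / (1−τ)` and `k τ^k < (1−τ)² ε / (2r)` where `τ := αβ ∈ (0,1)`,
then `π̃` is `ε`-optimal: `‖v^π̃ − v*‖_ξ < ε`. -/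
theorem modified_policy_iteration_epsilon_optimal
    {n m l : ℕ} (Xs : Set (Fin n → ℝ)) (Us : Set (Fin m → ℝ)) (Ws : Set (Fin l → ℝ))
    (hXs : MeasurableSet Xs) (hUs : MeasurableSet Us) (hWs : MeasurableSet Ws)
    (f : ↥Xs → ↥Us → ↥Ws → ↥Xs)
    (hf : Measurable fun q : (↥Xs × ↥Us) × ↥Ws => f q.1.1 q.1.2 q.2)
    (c : ↥Xs → ↥Us → ℝ) (hc : Measurable fun q : ↥Xs × ↥Us => c q.1 q.2)
    (α : ℝ) (hα0 : 0 < α) (hα1 : α < 1)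
    (Uadm : ↥Xs → Set ↥Us) (hUne : ∀ x, (Uadm x).Nonempty)
    (D : Set (Measure ↥Ws)) (hDne : D.Nonempty)
    (hDprob : ∀ μ ∈ D, IsProbabilityMeasure μ)
    (ξ : ↥Xs → ℝ) (hξm : Measurable ξ) (hξ1 : ∀ x, 1 ≤ ξ x)
    (b β : ℝ) (hb : 0 ≤ b) (hβ1 : 1 ≤ β) (hβ : β < 1 / α)
    (hcb : ∀ x, ∀ u ∈ Uadm x, |c x u| ≤ b * ξ x)
    (hξint : ∀ x, ∀ u ∈ Uadm x, ∀ μ ∈ D, Integrable (fun w => ξ (f x u w)) μ)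
    (hξbound : ∀ x, ∀ u ∈ Uadm x, ∀ μ ∈ D, ∫ w, ξ (f x u w) ∂μ ≤ β * ξ x)
    (ε r : ℝ) (hε : 0 < ε) (hr : 0 < r) (k : ℕ) (hk1 : 1 ≤ k)
    (πtil : ↥Xs → ↥Us) (hπm : Measurable πtil) (hπadm : ∀ x, πtil x ∈ Uadm x)
    (vtil vstar vπ : ↥Xs → ℝ)
    (hvtilm : Measurable vtil) (hvstarm : Measurable vstar) (hvπm : Measurable vπ)
    (hvtilb : BddAbove (Set.range fun x => |vtil x| / ξ x))
    (hvstarb : BddAbove (Set.range fun x => |vstar x| / ξ x))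
    (hvπb : BddAbove (Set.range fun x => |vπ x| / ξ x))
    (hfix : ∀ x, Tbell f c α Uadm D vstar x = vstar x)
    (hfixπ : ∀ x, Tpol f c α πtil D vπ x = vπ x)
    (hgreedy : ∀ x, Tpol f c α πtil D vtil x = Tbell f c α Uadm D vtil x)
    (hclose : wnorm ξ (fun x => vtil x - vstar x)
        ≤ (k : ℝ) * (α * β) ^ (k - 1) * r / (1 - α * β))
    (hkcond : (k : ℝ) * (α * β) ^ k < (1 - α * β) ^ 2 * ε / (2 * r)) :
    wnorm ξ (fun x => vπ x - vstar x) < ε := by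
  have hξ : ∀ x, 0 < ξ x := fun x => one_pos.trans_le (hξ1 x)
  have hτ0 : 0 < α * β := mul_pos hα0 (one_pos.trans_le hβ1)
  have hτ1 : 0 < 1 - α * β := by
    rw [lt_div_iff₀ hα0] at hβ
    linarith
  have hint : ∀ {v : ↥Xs → ℝ}, Measurable v → BddAbove (Set.range fun x => |v x| / ξ x) →
      ∀ x, ∀ u ∈ Uadm x, ∀ μ ∈ D, Integrable (fun w => v (f x u w)) μ :=
    fun hv hvb x u hu μ hμ => integrable_comp_of_abs_le_mul
      (hf.comp (measurable_const.prodMk measurable_id : Measurable fun w => ((x, u), w))) hv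
      (abs_le_wnorm_mul hξ hvb) (hξint x u hu μ hμ)
  have hdiff : ∀ {v v' : ↥Xs → ℝ}, Measurable v → Measurable v' →
      BddAbove (Set.range fun x => |v x| / ξ x) → BddAbove (Set.range fun x => |v' x| / ξ x) →
      ∀ {M : ℝ}, 0 ≤ M → (∀ x, |v x - v' x| ≤ M * ξ x) → ∀ x, ∀ u ∈ Uadm x, ∀ μ ∈ D,
      |∫ w, v (f x u w) ∂μ - ∫ w, v' (f x u w) ∂μ| ≤ M * (β * ξ x) :=
    fun hv hv' hvb hvb' M hM h x u hu μ hμ =>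
      (abs_integral_comp_sub_le (hint hv hvb x u hu μ hμ) (hint hv' hvb' x u hu μ hμ)
        (hξint x u hu μ hμ) h).trans (mul_le_mul_of_nonneg_left (hξbound x u hu μ hμ) hM)
  have hβξ : ∀ x, 0 ≤ β * ξ x := fun x => mul_nonneg (by linarith) (hξ x).le
  set a := wnorm ξ fun x => vπ x - vstar x
  set δ := wnorm ξ fun x => vtil x - vstar x
  have ha0 : 0 ≤ a := wnorm_nonneg hξ _
  have hδ0 : 0 ≤ δ := wnorm_nonneg hξ _
  have hπstar : ∀ x, |vπ x - vstar x| ≤ a * ξ x :=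
    abs_le_wnorm_mul hξ (bddAbove_range_abs_sub_div hξ hvπb hvstarb)
  have htilstar : ∀ x, |vtil x - vstar x| ≤ δ * ξ x :=
    abs_le_wnorm_mul hξ (bddAbove_range_abs_sub_div hξ hvtilb hvstarb)
  have hπtil : ∀ x, |vπ x - vtil x| ≤ (a + δ) * ξ x := fun x => by
    have := abs_sub_le (vπ x) (vstar x) (vtil x)
    rw [abs_sub_comm (vstar x)] at this
    linarith [hπstar x, htilstar x]
  have hrec : a ≤ α * β * (a + 2 * δ) := by
    refine wnorm_le_of_forall_abs_le hξ (by positivity) fun x => ?_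
    have h₁ := abs_Tpol_sub_Tpol_le (c := c) hα0.le
      (mul_nonneg (add_nonneg ha0 hδ0) (hβξ x))
      (hdiff hvπm hvtilm hvπb hvtilb (add_nonneg ha0 hδ0) hπtil x (πtil x) (hπadm x))
    have h₂ := abs_Tbell_sub_Tbell_le (c := c) hα0.le (mul_nonneg hδ0 (hβξ x))
      (hdiff hvtilm hvstarm hvtilb hvstarb hδ0 htilstar x)
    rw [hfixπ, hgreedy] at h₁
    rw [hfix] at h₂
    linarith [abs_sub_le (vπ x) (Tbell f c α Uadm D vtil x) (vstar x)]
  have hpow : α * β * ((k : ℝ) * (α * β) ^ (k - 1)) = k * (α * β) ^ k := by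
    rw [mul_left_comm, mul_pow_sub_one (by lia)]
  rw [le_div_iff₀ hτ1] at hclose
  rw [lt_div_iff₀ (by positivity)] at hkcond
  have hbound : (1 - α * β) ^ 2 * a < (1 - α * β) ^ 2 * ε := by
    calc (1 - α * β) ^ 2 * a = (1 - α * β) * (a - α * β * a) := by ring
      _ ≤ (1 - α * β) * (2 * (α * β) * δ) :=
        mul_le_mul_of_nonneg_left (by linarith) hτ1.le
      _ = 2 * (α * β) * (δ * (1 - α * β)) := by ring
      _ ≤ 2 * (α * β) * (k * (α * β) ^ (k - 1) * r) :=
        mul_le_mul_of_nonneg_left hclose (by positivity)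
      _ = k * (α * β) ^ k * (2 * r) := by
        rw [← hpow]
        ring
      _ < (1 - α * β) ^ 2 * ε := hkcond
  exact lt_of_mul_lt_mul_left hbound (sq_nonneg _)
end

section
/- Let W be a closed subset of ℝ^l equipped with a continuous metric d, p ∈ [1,∞), ŵ^(1),…,ŵ^(N) ∈ W, ν_N := (1/N) Σ_{i=1}^N δ_{ŵ^(i)}, and θ > 0. Let g : W → ℝ be upper semicontinuous with ∫_W |g| dν_N < ∞ and suppose there exists λ₀ ≥ 0 with sup_{w ∈ W} [ g(w) − λ₀ d(w, ŵ^(i))^p ] < ∞ for every i. Then the strong duality sup { ∫_W g dμ : μ a Borel probability measure on W with W_p(μ, ν_N) ≤ θ } = inf { λ θ^p + (1/N) Σ_{i=1}^N ℓ_i : λ ≥ 0, ℓ ∈ ℝ^N, g(w) − λ d(w, ŵ^(i))^p ≤ ℓ_i for all w ∈ W and all i } holds; equivalently, the left-hand side equals inf_{λ ≥ 0} [ λ θ^p + (1/N) Σ_{i=1}^N sup_{w ∈ W} ( g(w) − λ d(w, ŵ^(i))^p ) ]. (Applied with g(w) := α v(f(x,u,w)) and adding the constant c(x,u), this gives the semi-infinite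 program reformulation of the Bellman operator: (T v)(x) equals the optimal value of the program minimizing λ θ^p + c(x,u) + (1/N) Σ ℓ_i over u ∈ U(x), λ ≥ 0, ℓ ∈ ℝ^N subject to α v(f(x,u,w)) − λ d(w, ŵ^(i))^p ≤ ℓ_i for all w ∈ W.) -/
open MeasureTheory ENNReal

/-- The order-`p` Wasserstein distance (as an extended nonnegative real) between two Borel
probability measures, defined as the infimum over couplings of the `p`-th root of the
transport cost. -/
noncomputable def Wdist {α : Type*} [MeasurableSpace α] (d : α → α → ℝ) (p : ℝ)
    (μ ν : Measure α) : ℝ≥0∞ :=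
  ⨅ κ ∈ {κ : Measure (α × α) | IsProbabilityMeasure κ ∧
      κ.map Prod.fst = μ ∧ κ.map Prod.snd = ν},
    (∫⁻ q, ENNReal.ofReal (d q.1 q.2 ^ p) ∂κ) ^ (1 / p)

section FiniteMeasures

variable {ι α β : Type*} [Fintype ι] [MeasurableSpace α] [MeasurableSpace β]

/-- The finitely supported measure with mass `c j` at the point `x j`. -/
noncomputable def weightedDirac (c : ι → ℝ≥0∞) (x : ι → α) : Measure α :=
  ∑ j, c j • Measure.dirac (x j)

theorem map_weightedDirac (c : ι → ℝ≥0∞) (x : ι → α) {f : α → β} (hf : Measurable f) :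
    (weightedDirac c x).map f = weightedDirac c (f ∘ x) := by
  ext s hs
  simp [weightedDirac, Measure.map_apply hf hs, hs, hf hs, Set.indicator]
  rfl

theorem lintegral_weightedDirac [MeasurableSingletonClass α] (c : ι → ℝ≥0∞) (x : ι → α)
    (f : α → ℝ≥0∞) : ∫⁻ a, f a ∂(weightedDirac c x) = ∑ j, c j * f (x j) := by
  simp [weightedDirac, lintegral_finsetSum_measure]

theorem integrable_weightedDirac [MeasurableSingletonClass α] {c : ι → ℝ≥0∞}
    (hc : ∀ j, c j ≠ ∞) (x : ι → α) (f : α → ℝ) : Integrable f (weightedDirac c x) := by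
  refine integrable_finsetSum_measure.2 fun j _ => Integrable.smul_measure ?_ (hc j)
  exact integrable_dirac enorm_lt_top

theorem integral_weightedDirac [MeasurableSingletonClass α] {c : ι → ℝ≥0∞}
    (hc : ∀ j, c j ≠ ∞) (x : ι → α) (f : α → ℝ) :
    ∫ a, f a ∂(weightedDirac c x) = ∑ j, (c j).toReal * f (x j) := by
  rw [weightedDirac, integral_finsetSum_measure fun j _ =>
    (integrable_dirac enorm_lt_top).smul_measure (hc j)]
  simp

theorem isProbabilityMeasure_weightedDirac {c : ι → ℝ≥0∞} (hc : ∑ j, c j = 1) (x : ι → α) :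
    IsProbabilityMeasure (weightedDirac c x) :=
  ⟨by simpa [weightedDirac] using hc⟩

/-- Pairing the atoms of two finitely supported measures bounds their Wasserstein distance. -/
theorem Wdist_weightedDirac_le [MeasurableSingletonClass α] {d : α → α → ℝ}
    (hd : ∀ w w', 0 ≤ d w w') {p : ℝ} (hp : 0 < p) {c : ι → ℝ≥0∞} (hc : ∑ j, c j = 1)
    (x y : ι → α) {θ : ℝ} (hθ : 0 ≤ θ)
    (h : ∑ j, (c j).toReal * d (x j) (y j) ^ p ≤ θ ^ p) :
    Wdist d p (weightedDirac c x) (weightedDirac c y) ≤ ENNReal.ofReal θ := by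
  have hfin : ∀ j, c j ≠ ∞ := fun j =>
    ne_top_of_le_ne_top one_ne_top
      (hc ▸ Finset.single_le_sum (fun _ _ => zero_le) (Finset.mem_univ j))
  refine (iInf₂_le (weightedDirac c fun j => (x j, y j))
    ⟨isProbabilityMeasure_weightedDirac hc _, map_weightedDirac c _ measurable_fst,
      map_weightedDirac c _ measurable_snd⟩).trans ?_
  rw [one_div, ENNReal.rpow_inv_le_iff hp, ENNReal.ofReal_rpow_of_nonneg hθ hp.le,
    lintegral_weightedDirac]
  refine le_trans (le_of_eq ?_) (ENNReal.ofReal_le_ofReal h)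
  rw [ENNReal.ofReal_sum_of_nonneg fun j _ =>
    mul_nonneg toReal_nonneg (Real.rpow_nonneg (hd _ _) _)]
  refine Finset.sum_congr rfl fun j _ => ?_
  rw [ENNReal.ofReal_mul toReal_nonneg, ENNReal.ofReal_toReal (hfin j)]

end FiniteMeasures

/-- A supporting line: if no two-point mixture of a family of points `(s i, v i)` whose first
coordinate is at most `τ` has second coordinate exceeding `V`, then the family lies below a
nondecreasing line through `(τ, V)`. -/
theorem exists_supporting_slope {ι : Type*} {s v : ι → ℝ} {τ V : ℝ}
    (hmix : ∀ i j, ∀ a b : ℝ, 0 ≤ a → 0 ≤ b → a + b = 1 → a * s i + b * s j ≤ τ →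
      a * v i + b * v j ≤ V)
    (hlt : ∃ i, s i < τ) :
    ∃ lam : ℝ, 0 ≤ lam ∧ ∀ i, v i ≤ V + lam * (s i - τ) := by
  have hV : ∀ i, s i ≤ τ → v i ≤ V := fun i hi => by
    simpa using hmix i i 1 0 zero_le_one le_rfl (by simp) (by simpa using hi)
  obtain ⟨i₀, hi₀⟩ := hlt
  have : Nonempty {i // s i < τ} := ⟨⟨i₀, hi₀⟩⟩
  let slope : {i // s i < τ} → ℝ := fun i => (V - v i) / (τ - s i)
  have hnonneg : ∀ i, 0 ≤ slope i := fun i =>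
    div_nonneg (sub_nonneg.2 (hV i i.2.le)) (sub_nonneg.2 i.2.le)
  refine ⟨⨅ i, slope i, le_ciInf hnonneg, fun j => ?_⟩
  rcases lt_trichotomy (s j) τ with hj | hj | hj
  · have h : (⨅ i, slope i) ≤ slope ⟨j, hj⟩ :=
      ciInf_le ⟨0, Set.forall_mem_range.2 hnonneg⟩ _
    rw [le_div_iff₀ (sub_pos.2 hj)] at h
    linarith
  · simpa [hj] using hV j hj.le
  · have h : (v j - V) / (s j - τ) ≤ ⨅ i, slope i := by
      refine le_ciInf fun i => ?_
      have hi : 0 < τ - s i := sub_pos.2 i.2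
      have hj' : 0 < s j - τ := sub_pos.2 hj
      have hD : 0 < s j - s i := by linarith
      have hm := hmix i j ((s j - τ) / (s j - s i)) ((τ - s i) / (s j - s i))
        (by positivity) (by positivity) (by field_simp; ring)
        (le_of_eq (by field_simp; ring))
      rw [div_le_div_iff₀ hj' hi]
      rw [div_mul_eq_mul_div, div_mul_eq_mul_div, ← add_div, div_le_iff₀ hD] at hm
      linarith
    rw [div_le_iff₀ (sub_pos.2 hj)] at h
    linarith

/-- A bound on all sums `∑ i, f i (w i)` splits into uniform bounds on the summands. -/
theorem exists_forall_le_of_forall_sum_le {ι α : Type*} [Fintype ι] [Nonempty ι] [Nonempty α]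
    {f : ι → α → ℝ} {K : ℝ} (h : ∀ w : ι → α, ∑ i, f i (w i) ≤ K) :
    ∃ ℓ : ι → ℝ, (∀ i w, f i w ≤ ℓ i) ∧ ∑ i, ℓ i ≤ K := by
  classical
  let z : α := Classical.arbitrary α
  have hbdd : ∀ i, BddAbove (Set.range (f i)) := fun i => by
    refine ⟨K - ∑ j ∈ Finset.univ.erase i, f j z, Set.forall_mem_range.2 fun w => ?_⟩
    have hw := h (Function.update (fun _ => z) i w)
    have herase : ∑ j ∈ Finset.univ.erase i, f j (Function.update (fun _ => z) i w j)
        = ∑ j ∈ Finset.univ.erase i, f j z :=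
      Finset.sum_congr rfl fun j hj => by
        rw [Function.update_of_ne (Finset.ne_of_mem_erase hj)]
    rw [← Finset.add_sum_erase _ _ (Finset.mem_univ i), herase, Function.update_self] at hw
    linarith
  refine ⟨fun i => ⨆ w, f i w, fun i w => le_ciSup (hbdd i) w,
    le_of_forall_pos_le_add fun ε hε => ?_⟩
  have hcard : (0 : ℝ) < Fintype.card ι := by exact_mod_cast Fintype.card_pos
  have hlt : ∀ i, ∃ w, (⨆ w, f i w) - ε / Fintype.card ι < f i w := fun i =>
    exists_lt_of_lt_ciSup (sub_lt_self _ (by positivity))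
  choose w hw using hlt
  have hsum := (Finset.sum_le_sum fun i (_ : i ∈ Finset.univ) => (hw i).le).trans (h w)
  rw [Finset.sum_sub_distrib, Finset.sum_const, Finset.card_univ, nsmul_eq_mul,
    mul_div_cancel₀ _ hcard.ne'] at hsum
  linarith

/-- Weak duality for the Wasserstein ball around a finitely supported measure. -/
theorem integral_le_of_Wdist_le {ι α : Type*} [Fintype ι] [Nonempty α] [MeasurableSpace α]
    [TopologicalSpace α] [SecondCountableTopology α] [TopologicalSpace.PseudoMetrizableSpace α]
    [OpensMeasurableSpace α] [MeasurableSingletonClass α]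
    {d : α → α → ℝ} (hd_cont : Continuous fun q : α × α => d q.1 q.2)
    (hd : ∀ w w', 0 ≤ d w w') {p : ℝ} (hp : 0 < p) {c : ι → ℝ≥0∞} (hc : ∀ j, c j ≠ ∞)
    {y : ι → α} {θ : ℝ} (hθ : 0 ≤ θ) {g : α → ℝ} {μ : Measure α} (hg : Integrable g μ)
    (hμ : Wdist d p μ (weightedDirac c y) ≤ ENNReal.ofReal θ) {lam : ℝ} (hlam : 0 ≤ lam)
    {ℓ : ι → ℝ} (hℓ : ∀ i w, g w - lam * d w (y i) ^ p ≤ ℓ i) :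
    ∫ w, g w ∂μ ≤ lam * θ ^ p + ∑ i, (c i).toReal * ℓ i := by
  have key : ∀ r, θ < r → ∫ w, g w ∂μ ≤ lam * r ^ p + ∑ i, (c i).toReal * ℓ i := by
    intro r hr
    have hr0 : 0 < r := hθ.trans_lt hr
    have hlt : Wdist d p μ (weightedDirac c y) < ENNReal.ofReal r :=
      hμ.trans_lt ((ENNReal.ofReal_lt_ofReal_iff hr0).2 hr)
    simp only [Wdist, iInf_lt_iff] at hlt
    obtain ⟨κ, ⟨hκ, hfst, hsnd⟩, hcost⟩ := hlt
    have hle : ∫⁻ q, ENNReal.ofReal (d q.1 q.2 ^ p) ∂κ ≤ ENNReal.ofReal (r ^ p) := by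
      rw [← ENNReal.ofReal_rpow_of_nonneg hr0.le hp.le, ← ENNReal.rpow_inv_le_iff hp, ← one_div]
      exact hcost.le
    have hcont : Continuous fun q : α × α => d q.1 q.2 ^ p :=
      hd_cont.rpow_const fun _ => Or.inr hp.le
    have hpos : ∀ q : α × α, 0 ≤ d q.1 q.2 ^ p := fun q => Real.rpow_nonneg (hd _ _) _
    have hint : Integrable (fun q : α × α => d q.1 q.2 ^ p) κ := by
      refine ⟨hcont.aestronglyMeasurable, ?_⟩
      rw [hasFiniteIntegral_iff_ofReal (Filter.Eventually.of_forall hpos)]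
      exact hle.trans_lt ofReal_lt_top
    have hcost' : ∫ q, d q.1 q.2 ^ p ∂κ ≤ r ^ p := by
      rw [integral_eq_lintegral_of_nonneg_ae (Filter.Eventually.of_forall hpos)
        hcont.aestronglyMeasurable]
      exact ENNReal.toReal_le_of_le_ofReal (by positivity) hle
    let L : α → ℝ := fun w' => ⨆ w, (g w - lam * d w w' ^ p)
    have hL : Integrable L (κ.map Prod.snd) := hsnd ▸ integrable_weightedDirac hc y L
    have hg' : Integrable g (κ.map Prod.fst) := hfst ▸ hg
    have hae : ∀ᵐ q ∂κ, q.2 ∈ Set.range y := by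
      refine ae_of_ae_map (p := (· ∈ Set.range y)) measurable_snd.aemeasurable ?_
      rw [hsnd, ae_iff]
      have : MeasurableSet {a | a ∉ Set.range y} := (Set.finite_range y).measurableSet.compl
      simp [weightedDirac]
    calc ∫ w, g w ∂μ = ∫ q, g q.1 ∂κ := by
          rw [← hfst, integral_map measurable_fst.aemeasurable hg'.1]
      _ ≤ ∫ q, (lam * d q.1 q.2 ^ p + L q.2) ∂κ := by
          refine integral_mono_ae (hg'.comp_measurable measurable_fst)
            ((hint.const_mul lam).add (hL.comp_measurable measurable_snd)) ?_
          filter_upwards [hae] with q hq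
          obtain ⟨i, hi⟩ := hq
          have := le_ciSup (f := fun w => g w - lam * d w q.2 ^ p)
            ⟨ℓ i, Set.forall_mem_range.2 fun w => hi ▸ hℓ i w⟩ q.1
          simp only [L]
          linarith
      _ = lam * ∫ q, d q.1 q.2 ^ p ∂κ + ∑ i, (c i).toReal * L (y i) := by
          have hadd := integral_add (hint.const_mul lam) (hL.comp_measurable measurable_snd)
          simp only [Function.comp_apply] at hadd
          rw [hadd, integral_const_mul, ← integral_weightedDirac hc, ← hsnd,
            integral_map measurable_snd.aemeasurable hL.1]
      _ ≤ lam * r ^ p + ∑ i, (c i).toReal * ℓ i := by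
          gcongr with i
          exact ciSup_le (hℓ i)
  have hcontr : Continuous fun r : ℝ => lam * r ^ p + ∑ i, (c i).toReal * ℓ i :=
    (continuous_const.mul (Real.continuous_rpow_const hp.le)).add continuous_const
  exact ge_of_tendsto (hcontr.continuousWithinAt (s := Set.Ioi θ) (x := θ))
    (Filter.eventually_of_mem self_mem_nhdsWithin key)

theorem EReal.coe_finset_sum {ι : Type*} (s : Finset ι) (f : ι → ℝ) :
    ((∑ i ∈ s, f i : ℝ) : EReal) = ∑ i ∈ s, (f i : EReal) := by
  classical
  induction s using Finset.induction_on with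
  | empty => simp
  | insert a s ha ih => simp [Finset.sum_insert ha, ih]

theorem EReal.finset_sum_ne_bot {ι : Type*} {s : Finset ι} {f : ι → EReal}
    (h : ∀ i ∈ s, f i ≠ ⊥) : ∑ i ∈ s, f i ≠ ⊥ := by
  classical
  induction s using Finset.induction_on with
  | empty => simp
  | insert a s ha ih =>
    rw [Finset.sum_insert ha, Ne, EReal.add_eq_bot_iff, not_or]
    exact ⟨h a (by simp), ih fun i hi => h i (by simp [hi])⟩

/-- Eliminating the epigraphical variables of the semi-infinite dual program. -/
theorem iInf_semiInfinite_eq_iInf_iSup {α : Type*} [Nonempty α] {N : ℕ} (hN : 0 < N)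
    (g : α → ℝ) (cost : Fin N → α → ℝ) (τ : ℝ) :
    (⨅ q : {q : ℝ × (Fin N → ℝ) // 0 ≤ q.1 ∧ ∀ i, ∀ w, g w - q.1 * cost i w ≤ q.2 i},
        ((q.1.1 * τ + (1 / N : ℝ) * ∑ i, q.1.2 i : ℝ) : EReal))
      = ⨅ lam : {lam : ℝ // 0 ≤ lam},
          ((lam.1 * τ : ℝ) : EReal)
            + ((1 / N : ℝ) : EReal) * ∑ i, ⨆ w, ((g w - lam.1 * cost i w : ℝ) : EReal) := by
  have hN' : (0 : ℝ) < 1 / N := by positivity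
  apply le_antisymm
  · refine le_iInf fun ⟨lam, hlam⟩ => ?_
    have hbot : ∀ i, (⨆ w, ((g w - lam * cost i w : ℝ) : EReal)) ≠ ⊥ := fun i =>
      ne_bot_of_le_ne_bot (EReal.coe_ne_bot _)
        (le_iSup (fun w => ((g w - lam * cost i w : ℝ) : EReal)) (Classical.arbitrary α))
    by_cases htop : ∃ i, (⨆ w, ((g w - lam * cost i w : ℝ) : EReal)) = ⊤
    · obtain ⟨i, hi⟩ := htop
      have hsum : ∑ i, (⨆ w, ((g w - lam * cost i w : ℝ) : EReal)) = ⊤ := by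
        rw [← Finset.add_sum_erase _ _ (Finset.mem_univ i), hi]
        exact EReal.top_add_of_ne_bot (EReal.finset_sum_ne_bot fun j _ => hbot j)
      simp only [hsum]
      rw [EReal.coe_mul_top_of_pos hN', EReal.coe_add_top]
      exact le_top
    · push Not at htop
      have hcoe : ∀ i, (((⨆ w, ((g w - lam * cost i w : ℝ) : EReal)).toReal : ℝ) : EReal)
          = ⨆ w, ((g w - lam * cost i w : ℝ) : EReal) := fun i =>
        EReal.coe_toReal (htop i) (hbot i)
      have hmem : ∀ i w, g w - lam * cost i w
          ≤ (⨆ w, ((g w - lam * cost i w : ℝ) : EReal)).toReal := fun i w => by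
        rw [← EReal.coe_le_coe_iff, hcoe]
        exact le_iSup (fun w => ((g w - lam * cost i w : ℝ) : EReal)) w
      refine (iInf_le _ ⟨(lam, fun i => (⨆ w, ((g w - lam * cost i w : ℝ) : EReal)).toReal),
        hlam, hmem⟩).trans ?_
      rw [EReal.coe_add, EReal.coe_mul (1 / N : ℝ), EReal.coe_finset_sum]
      simp only [hcoe, le_refl]
  · refine le_iInf fun ⟨⟨lam, ℓ⟩, hlam, hℓ⟩ => (iInf_le _ ⟨lam, hlam⟩).trans ?_
    rw [EReal.coe_add, EReal.coe_mul (1 / N : ℝ), EReal.coe_finset_sum]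
    refine add_le_add le_rfl (mul_le_mul_of_nonneg_left ?_ (EReal.coe_nonneg.2 hN'.le))
    exact Finset.sum_le_sum fun i _ => iSup_le fun w => EReal.coe_le_coe_iff.2 (hℓ i w)

/-- strong duality for worst-case expectation over a Wasserstein ball,
underlying Proposition 1: for upper semicontinuous `g` with `∫|g| dν_N < ∞` and a
Slater-type condition, the worst-case expectation over the Wasserstein ball of radius `θ`
equals the optimal value of the semi-infinite dual program, equivalently the dual infimum
over `λ ≥ 0` of `λ θ^p + (1/N) ∑ᵢ sup_w [g(w) − λ d(w, ŵ⁽ⁱ⁾)^p]`. -/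
theorem wasserstein_strong_duality
    {l : ℕ} (W : Set (Fin l → ℝ)) (hWclosed : IsClosed W)
    (d : ↥W → ↥W → ℝ)
    (hd_cont : Continuous fun q : ↥W × ↥W => d q.1 q.2)
    (hd_nonneg : ∀ w w', 0 ≤ d w w')
    (hd_eq_zero : ∀ w w', d w w' = 0 ↔ w = w')
    (hd_symm : ∀ w w', d w w' = d w' w)
    (hd_triangle : ∀ w w' w'', d w w'' ≤ d w w' + d w' w'')
    (p : ℝ) (hp : 1 ≤ p)
    (N : ℕ) (hN : 0 < N) (what : Fin N → ↥W)
    (ν : Measure ↥W) (hν : ν = ((N : ℝ≥0∞))⁻¹ • ∑ i, Measure.dirac (what i))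
    (θ : ℝ) (hθ : 0 < θ)
    (g : ↥W → ℝ) (husc : UpperSemicontinuous g) (hgν : Integrable g ν)
    (lam0 : ℝ) (hlam0 : 0 ≤ lam0)
    (hslater : ∀ i, BddAbove (Set.range fun w : ↥W => g w - lam0 * d w (what i) ^ p)) :
    (⨆ μ : {μ : Measure ↥W // IsProbabilityMeasure μ ∧ Integrable g μ ∧
          Wdist d p μ ν ≤ ENNReal.ofReal θ},
        ((∫ w, g w ∂μ.1 : ℝ) : EReal))
      = ⨅ q : {q : ℝ × (Fin N → ℝ) // 0 ≤ q.1 ∧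
            ∀ i, ∀ w : ↥W, g w - q.1 * d w (what i) ^ p ≤ q.2 i},
          ((q.1.1 * θ ^ p + (1 / N : ℝ) * ∑ i, q.1.2 i : ℝ) : EReal)
    ∧ (⨆ μ : {μ : Measure ↥W // IsProbabilityMeasure μ ∧ Integrable g μ ∧
          Wdist d p μ ν ≤ ENNReal.ofReal θ},
        ((∫ w, g w ∂μ.1 : ℝ) : EReal))
      = ⨅ lam : {lam : ℝ // 0 ≤ lam},
          ((lam.1 * θ ^ p : ℝ) : EReal)
            + ((1 / N : ℝ) : EReal)
              * ∑ i, ⨆ w : ↥W, ((g w - lam.1 * d w (what i) ^ p : ℝ) : EReal) := by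
  have hp0 : 0 < p := zero_lt_one.trans_le hp
  have : Nonempty (Fin N) := ⟨⟨0, hN⟩⟩
  have : Nonempty ↥W := ⟨what ⟨0, hN⟩⟩
  have hN' : (N : ℝ) ≠ 0 := by positivity
  have hNe : (N : ℝ≥0∞) ≠ 0 := by exact_mod_cast hN.ne'
  have hνw : ν = weightedDirac (fun _ => (N : ℝ≥0∞)⁻¹) what := by
    rw [hν, weightedDirac, Finset.smul_sum]
  refine (and_iff_left_of_imp fun h => h.trans
    (iInf_semiInfinite_eq_iInf_iSup hN g (fun i w => d w (what i) ^ p) (θ ^ p))).2 ?_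
  have hweak : ∀ (μ : {μ : Measure ↥W // IsProbabilityMeasure μ ∧ Integrable g μ ∧
        Wdist d p μ ν ≤ ENNReal.ofReal θ})
      (q : {q : ℝ × (Fin N → ℝ) // 0 ≤ q.1 ∧
        ∀ i, ∀ w : ↥W, g w - q.1 * d w (what i) ^ p ≤ q.2 i}),
      ((∫ w, g w ∂μ.1 : ℝ) : EReal)
        ≤ ((q.1.1 * θ ^ p + (1 / N : ℝ) * ∑ i, q.1.2 i : ℝ) : EReal) := by
    rintro ⟨μ, -, hg, hμ⟩ ⟨⟨lam, ℓ⟩, hlam, hℓ⟩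
    have := integral_le_of_Wdist_le hd_cont hd_nonneg hp0 (fun _ => ENNReal.inv_ne_top.2 hNe)
      hθ.le hg (hνw ▸ hμ) hlam hℓ
    rw [EReal.coe_le_coe_iff]
    simpa [Finset.mul_sum] using this
  refine le_antisymm (iSup_le fun μ => le_iInf fun q => hweak μ q) ?_
  let s : (Fin N → ↥W) → ℝ := fun w => (1 / N : ℝ) * ∑ i, d (w i) (what i) ^ p
  let v : (Fin N → ↥W) → ℝ := fun w => (1 / N : ℝ) * ∑ i, g (w i)
  set A := ⨆ μ : {μ : Measure ↥W // IsProbabilityMeasure μ ∧ Integrable g μ ∧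
          Wdist d p μ ν ≤ ENNReal.ofReal θ}, ((∫ w, g w ∂μ.1 : ℝ) : EReal) with hA
  have hfeas : ∀ w w' : Fin N → ↥W, ∀ a b : ℝ, 0 ≤ a → 0 ≤ b → a + b = 1 →
      a * s w + b * s w' ≤ θ ^ p → ((a * v w + b * v w' : ℝ) : EReal) ≤ A := by
    intro w w' a b ha hb hab hs
    let c : Fin N ⊕ Fin N → ℝ≥0∞ := Sum.elim
      (fun _ => ENNReal.ofReal a * (N : ℝ≥0∞)⁻¹) (fun _ => ENNReal.ofReal b * (N : ℝ≥0∞)⁻¹)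
    have hc : ∀ j, c j ≠ ∞ := by
      rintro (j | j) <;> exact ENNReal.mul_ne_top ofReal_ne_top (ENNReal.inv_ne_top.2 hNe)
    have hab' : ENNReal.ofReal a + ENNReal.ofReal b = 1 := by
      rw [← ENNReal.ofReal_add ha hb, hab, ofReal_one]
    have hc1 : ∑ j, c j = 1 := by
      simp only [c, Fintype.sum_sum_type, Sum.elim_inl, Sum.elim_inr, Finset.sum_const,
        Finset.card_univ, Fintype.card_fin, nsmul_eq_mul]
      rw [← mul_add, ← add_mul, hab', one_mul, ENNReal.mul_inv_cancel hNe (natCast_ne_top N)]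
    have hνc : ν = weightedDirac c (Sum.elim what what) := by
      rw [hνw]
      simp only [weightedDirac, c, Fintype.sum_sum_type, Sum.elim_inl, Sum.elim_inr]
      rw [← Finset.sum_add_distrib]
      refine Finset.sum_congr rfl fun i _ => ?_
      rw [← add_smul, ← add_mul, hab', one_mul]
    have hsum : ∀ f : Fin N ⊕ Fin N → ℝ, ∑ j, (c j).toReal * f j
        = a * ((1 / N : ℝ) * ∑ i, f (.inl i)) + b * ((1 / N : ℝ) * ∑ i, f (.inr i)) := by
      intro f
      simp [c, Fintype.sum_sum_type, Finset.mul_sum, ha, hb, mul_assoc]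
    have hdist := Wdist_weightedDirac_le hd_nonneg hp0 hc1 (Sum.elim w w')
      (Sum.elim what what) hθ.le (by rw [hsum]; exact hs)
    have hval : ∫ x, g x ∂(weightedDirac c (Sum.elim w w')) = a * v w + b * v w' := by
      rw [integral_weightedDirac hc, hsum fun j => g (Sum.elim w w' j)]
      rfl
    rw [← hval]
    exact le_iSup (fun μ : {μ : Measure ↥W // IsProbabilityMeasure μ ∧ Integrable g μ ∧
      Wdist d p μ ν ≤ ENNReal.ofReal θ} => ((∫ w, g w ∂μ.1 : ℝ) : EReal))
      ⟨_, isProbabilityMeasure_weightedDirac hc1 _, integrable_weightedDirac hc _ _,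
        hνc ▸ hdist⟩
  have hs0 : s what < θ ^ p := by
    have h0 : ∀ w, d w w = 0 := fun w => (hd_eq_zero w w).2 rfl
    simpa [s, h0, Real.zero_rpow hp0.ne'] using Real.rpow_pos_of_pos hθ p
  rcases eq_or_ne A ⊤ with htop | htop
  · rw [htop]; exact le_top
  have hbot : A ≠ ⊥ := ne_bot_of_le_ne_bot (EReal.coe_ne_bot _)
    (hfeas what what 1 0 zero_le_one le_rfl (by simp) (by simpa using hs0.le))
  lift A to ℝ using ⟨htop, hbot⟩ with V
  obtain ⟨lam, hlam, hline⟩ := exists_supporting_slope (s := s) (v := v) (τ := θ ^ p) (V := V)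
    (fun w w' a b ha hb hab hs => EReal.coe_le_coe_iff.1 (hfeas w w' a b ha hb hab hs))
    ⟨what, hs0⟩
  obtain ⟨ℓ, hℓ, hsum⟩ := exists_forall_le_of_forall_sum_le
    (f := fun i w => g w - lam * d w (what i) ^ p) (K := N * (V - lam * θ ^ p)) fun w => by
      have h := mul_le_mul_of_nonneg_left (hline w) (Nat.cast_nonneg (α := ℝ) N)
      have hv : N * v w = ∑ i, g (w i) := by simp [v, hN']
      have hs : N * s w = ∑ i, d (w i) (what i) ^ p := by simp [s, hN']
      rw [Finset.sum_sub_distrib, ← Finset.mul_sum, ← hv, ← hs]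
      linarith
  refine (iInf_le _ ⟨(lam, ℓ), hlam, hℓ⟩).trans (EReal.coe_le_coe_iff.2 ?_)
  have h := mul_le_mul_of_nonneg_left hsum (one_div_nonneg.2 (Nat.cast_nonneg (α := ℝ) N))
  rw [← mul_assoc, one_div_mul_cancel hN', one_mul] at h
  dsimp only
  linarith
end

section
/- Let W be a Borel subset of ℝ^l with a metric d, p ∈ [1,∞), ŵ^(1),…,ŵ^(N) ∈ W, ν_N := (1/N) Σ_{i=1}^N δ_{ŵ^(i)}, θ > 0, and D := {μ : W_p(μ,ν_N) ≤ θ}. Fix x and a Borel-measurable policy π with π(x) ∈ U(x), and let v^π be Borel-measurable with w ↦ v^π(f(x,π(x),w)) integrable against finitely-supported measures. Suppose (w̲^(1),…,w̲^(N), w̄^(1),…,w̄^(N), q) is an optimal solution of the finite-dimensional problem: maximize c(x,π(x)) + (α/N) Σ_{i=1}^N [ q_1 v^π(f(x,π(x),w̲^(i))) + q_2 v^π(f(x,π(x),w̄^(i))) ] over points in W^{2N} and q_1,q_2 ≥ 0 with q_1+q_2 = 1 subject to (1/N) Σ_{i=1}^N [ q_1 d(w̲^(i),ŵ^(i))^p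 + q_2 d(w̄^(i),ŵ^(i))^p ] ≤ θ^p, and suppose the optimal value of this problem equals (T^π v^π)(x). Then the discrete measure μ* := (1/N) Σ_{i=1}^N ( q_1 δ_{w̲^(i)} + q_2 δ_{w̄^(i)} ) belongs to D and attains the supremum in (T^π v^π)(x), i.e., c(x,π(x)) + α ∫_W v^π(f(x,π(x),w)) μ*(dw) = sup_{μ ∈ D} [ c(x,π(x)) + α ∫_W v^π(f(x,π(x),w)) μ(dw) ]; hence μ* is a worst-case distribution at x. -/
open MeasureTheory ENNReal

/-- The uniform average over `i` of the two-point measures `q₁ δ_{a i} + q₂ δ_{b i}`. -/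
noncomputable def twoPointMixture {S : Type*} [MeasurableSpace S] {N : ℕ} (q1 q2 : ℝ)
    (a b : Fin N → S) : Measure S :=
  ((N : ℝ≥0∞))⁻¹ • ∑ i,
    (ENNReal.ofReal q1 • Measure.dirac (a i) + ENNReal.ofReal q2 • Measure.dirac (b i))

namespace twoPointMixture

variable {S T : Type*} [MeasurableSpace S] [MeasurableSpace T] {N : ℕ} {q1 q2 : ℝ}

lemma of_eq (hq1 : 0 ≤ q1) (hq2 : 0 ≤ q2) (hq : q1 + q2 = 1) (a : Fin N → S) :
    twoPointMixture q1 q2 a a = ((N : ℝ≥0∞))⁻¹ • ∑ i, Measure.dirac (a i) := by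
  simp only [twoPointMixture, ← add_smul, ← ENNReal.ofReal_add hq1 hq2, hq, ENNReal.ofReal_one,
    one_smul]

lemma isProbabilityMeasure (hN : 0 < N) (hq1 : 0 ≤ q1) (hq2 : 0 ≤ q2) (hq : q1 + q2 = 1)
    (a b : Fin N → S) : IsProbabilityMeasure (twoPointMixture q1 q2 a b) := by
  constructor
  simp only [twoPointMixture, Measure.smul_apply, Measure.finsetSum_apply, Measure.add_apply,
    smul_eq_mul, measure_univ, mul_one, ← ENNReal.ofReal_add hq1 hq2, hq, ENNReal.ofReal_one,
    Finset.sum_const, Finset.card_univ, Fintype.card_fin, nsmul_eq_mul]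
  exact ENNReal.inv_mul_cancel (by exact_mod_cast hN.ne') (ENNReal.natCast_ne_top N)

lemma map_eq (a b : Fin N → S) {g : S → T} (hg : Measurable g) :
    (twoPointMixture q1 q2 a b).map g =
      twoPointMixture q1 q2 (fun i => g (a i)) (fun i => g (b i)) := by
  simp only [twoPointMixture, ← Measure.mapₗ_apply_of_measurable hg, map_smul,
    map_sum, map_add]
  simp only [Measure.mapₗ_apply_of_measurable hg, Measure.map_dirac' hg]

variable [MeasurableSingletonClass S]

lemma lintegral_ofReal (hN : 0 < N) (hq1 : 0 ≤ q1) (hq2 : 0 ≤ q2) (a b : Fin N → S) {g : S → ℝ}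
    (hg : ∀ s, 0 ≤ g s) :
    ∫⁻ s, ENNReal.ofReal (g s) ∂(twoPointMixture q1 q2 a b) =
      ENNReal.ofReal ((1 / N : ℝ) * ∑ i, (q1 * g (a i) + q2 * g (b i))) := by
  have hN' : (0 : ℝ) < N := by exact_mod_cast hN
  have h1 : ∀ i, 0 ≤ q1 * g (a i) := fun i => mul_nonneg hq1 (hg _)
  have h2 : ∀ i, 0 ≤ q2 * g (b i) := fun i => mul_nonneg hq2 (hg _)
  rw [ENNReal.ofReal_mul (by positivity),
    ENNReal.ofReal_sum_of_nonneg fun i _ => add_nonneg (h1 i) (h2 i), one_div,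
    ENNReal.ofReal_inv_of_pos hN', ENNReal.ofReal_natCast]
  simp only [twoPointMixture, lintegral_smul_measure, lintegral_finsetSum_measure,
    lintegral_add_measure, lintegral_dirac, smul_eq_mul, ENNReal.ofReal_add (h1 _) (h2 _),
    ENNReal.ofReal_mul hq1, ENNReal.ofReal_mul hq2]

lemma integral_eq (hq1 : 0 ≤ q1) (hq2 : 0 ≤ q2) (a b : Fin N → S) (g : S → ℝ) :
    ∫ s, g s ∂(twoPointMixture q1 q2 a b) =
      (1 / N : ℝ) * ∑ i, (q1 * g (a i) + q2 * g (b i)) := by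
  have hint : ∀ (q : ℝ) (s : S), Integrable g (ENNReal.ofReal q • Measure.dirac s) :=
    fun q s => (integrable_dirac (by simp)).smul_measure ENNReal.ofReal_ne_top
  rw [twoPointMixture, integral_smul_measure,
    integral_finsetSum_measure fun i _ => (hint q1 (a i)).add_measure (hint q2 (b i))]
  simp only [integral_add_measure (hint _ _) (hint _ _), integral_smul_measure, integral_dirac,
    ENNReal.toReal_ofReal hq1, ENNReal.toReal_ofReal hq2, smul_eq_mul, ENNReal.toReal_inv,
    ENNReal.toReal_natCast, one_div]

/-- Pairing the atoms over the same index bounds the Wasserstein distance between a mixture of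
two-point measures and the empirical measure. -/
lemma Wdist_le {d : S → S → ℝ} (hd : ∀ s t, 0 ≤ d s t) {p θ : ℝ} (hp : 0 < p) (hθ : 0 ≤ θ)
    (hN : 0 < N) (hq1 : 0 ≤ q1) (hq2 : 0 ≤ q2) (hq : q1 + q2 = 1) (a b c : Fin N → S)
    (hcost : (1 / N : ℝ) * ∑ i, (q1 * d (a i) (c i) ^ p + q2 * d (b i) (c i) ^ p) ≤ θ ^ p) :
    Wdist d p (twoPointMixture q1 q2 a b) (((N : ℝ≥0∞))⁻¹ • ∑ i, Measure.dirac (c i)) ≤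
      ENNReal.ofReal θ := by
  refine (iInf₂_le
    (twoPointMixture q1 q2 (fun i => (a i, c i)) (fun i => (b i, c i))) ?_).trans ?_
  · exact ⟨isProbabilityMeasure hN hq1 hq2 hq _ _, map_eq _ _ measurable_fst,
      (map_eq _ _ measurable_snd).trans (of_eq hq1 hq2 hq c)⟩
  · rw [lintegral_ofReal hN hq1 hq2 _ _ (g := fun s : S × S => d s.1 s.2 ^ p)
      fun s => Real.rpow_nonneg (hd _ _) p]
    calc _ ≤ (ENNReal.ofReal (θ ^ p)) ^ (1 / p) := by gcongr
      _ = ENNReal.ofReal θ := by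
        rw [ENNReal.ofReal_rpow_of_nonneg (Real.rpow_nonneg hθ p) (by positivity), one_div,
          Real.rpow_rpow_inv hθ hp.ne']

end twoPointMixture

/-- Proposition 4 of the paper: worst-case distribution policy: if
`(w̲, w̄, q)` is an optimal solution of the finite-dimensional reformulation of
`(T^π v^π)(x)` and its optimal value equals `(T^π v^π)(x)`, then the discrete measure
`μ* := (1/N) ∑ᵢ (q₁ δ_{w̲⁽ⁱ⁾} + q₂ δ_{w̄⁽ⁱ⁾})` lies in the Wasserstein ball `D` and
attains the supremum defining `(T^π v^π)(x)`, i.e. it is a worst-case distribution. -/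
theorem worst_case_distribution
    {n m l : ℕ} (Xs : Set (Fin n → ℝ)) (Us : Set (Fin m → ℝ)) (W : Set (Fin l → ℝ))
    (hW : MeasurableSet W)
    (d : ↥W → ↥W → ℝ)
    (hd_nonneg : ∀ w w', 0 ≤ d w w')
    (hd_eq_zero : ∀ w w', d w w' = 0 ↔ w = w')
    (hd_symm : ∀ w w', d w w' = d w' w)
    (hd_triangle : ∀ w w' w'', d w w'' ≤ d w w' + d w' w'')
    (p : ℝ) (hp : 1 ≤ p)
    (N : ℕ) (hN : 0 < N) (what : Fin N → ↥W)
    (ν : Measure ↥W) (hν : ν = ((N : ℝ≥0∞))⁻¹ • ∑ i, Measure.dirac (what i))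
    (θ : ℝ) (hθ : 0 < θ)
    (f : ↥Xs → ↥Us → ↥W → ↥Xs) (c : ↥Xs → ↥Us → ℝ)
    (α : ℝ) (hα0 : 0 < α) (hα1 : α < 1)
    (Uadm : ↥Xs → Set ↥Us)
    (π : ↥Xs → ↥Us) (hπm : Measurable π) (hπadm : ∀ y, π y ∈ Uadm y)
    (vπ : ↥Xs → ℝ) (hvπm : Measurable vπ) (x : ↥Xs)
    (hgm : Measurable fun w : ↥W => vπ (f x (π x) w))
    -- optimal solution of the finite-dimensional reformulation
    (wl wu : Fin N → ↥W) (q1 q2 : ℝ)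
    (hfeas : 0 ≤ q1 ∧ 0 ≤ q2 ∧ q1 + q2 = 1 ∧
      (1 / N : ℝ) * ∑ i, (q1 * d (wl i) (what i) ^ p + q2 * d (wu i) (what i) ^ p) ≤ θ ^ p)
    (hopt : ∀ (wl' wu' : Fin N → ↥W) (q1' q2' : ℝ),
      (0 ≤ q1' ∧ 0 ≤ q2' ∧ q1' + q2' = 1 ∧
        (1 / N : ℝ) * ∑ i, (q1' * d (wl' i) (what i) ^ p + q2' * d (wu' i) (what i) ^ p)
          ≤ θ ^ p) →
      c x (π x) + (α / N : ℝ) * ∑ i,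
          (q1' * vπ (f x (π x) (wl' i)) + q2' * vπ (f x (π x) (wu' i)))
        ≤ c x (π x) + (α / N : ℝ) * ∑ i,
            (q1 * vπ (f x (π x) (wl i)) + q2 * vπ (f x (π x) (wu i))))
    -- the optimal value of the finite-dimensional problem equals `(T^π v^π)(x)`
    (hval : c x (π x) + (α / N : ℝ) * ∑ i,
          (q1 * vπ (f x (π x) (wl i)) + q2 * vπ (f x (π x) (wu i)))
        = ⨆ μ : {μ : Measure ↥W // IsProbabilityMeasure μ ∧
            Wdist d p μ ν ≤ ENNReal.ofReal θ},
            c x (π x) + α * ∫ w, vπ (f x (π x) w) ∂μ.1)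
    (μstar : Measure ↥W)
    (hμstar : μstar = ((N : ℝ≥0∞))⁻¹ • ∑ i,
        (ENNReal.ofReal q1 • Measure.dirac (wl i) + ENNReal.ofReal q2 • Measure.dirac (wu i))) :
    (IsProbabilityMeasure μstar ∧ Wdist d p μstar ν ≤ ENNReal.ofReal θ)
    ∧ c x (π x) + α * ∫ w, vπ (f x (π x) w) ∂μstar
        = ⨆ μ : {μ : Measure ↥W // IsProbabilityMeasure μ ∧
            Wdist d p μ ν ≤ ENNReal.ofReal θ},
            c x (π x) + α * ∫ w, vπ (f x (π x) w) ∂μ.1 := by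
  obtain ⟨hq1, hq2, hq, hcost⟩ := hfeas
  change μstar = twoPointMixture q1 q2 wl wu at hμstar
  subst hμstar hν
  refine ⟨⟨twoPointMixture.isProbabilityMeasure hN hq1 hq2 hq wl wu,
    twoPointMixture.Wdist_le hd_nonneg (by linarith) hθ.le hN hq1 hq2 hq wl wu what hcost⟩, ?_⟩
  rw [← hval, twoPointMixture.integral_eq hq1 hq2]
  ring
end
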